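/- Marginal distribution of the multivariate Student-t: let n₁, n₂ be positive integers, k = n₁ + n₂, v > 0, μ ∈ ℝ^k, and let Σ be a k×k real symmetric positive definite matrix, with block decomposition μ = (μ₁, μ₂) and Σ = [[Σ₁₁, Σ₁₂],[Σ₂₁, Σ₂₂]] according to the splitting ℝ^k = ℝ^{n₁} × ℝ^{n₂}. Then for every x₁ ∈ ℝ^{n₁}, ∫_{ℝ^{n₂}} St((x₁,x₂); v, μ, Σ) dx₂ = St(x₁; v, μ₁, Σ₁₁). -/

import Mathlib

open Real MeasureTheory Matrix

/-- The multivariate Student-t density with `v` degrees of freedom, location `μ`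
and scale matrix `S`, on a finite index type `ι` (dimension `k = card ι`). -/
noncomputable def St {ι : Type*} [Fintype ι] [DecidableEq ι] (v : ℝ) (μ : ι → ℝ)
    (S : Matrix ι ι ℝ) (x : ι → ℝ) : ℝ :=
  Real.Gamma ((v + Fintype.card ι) / 2) /
      ((π * v) ^ ((Fintype.card ι : ℝ) / 2) * Real.Gamma (v / 2) *
        S.det ^ ((1 : ℝ) / 2)) *
    (1 + (x - μ) ⬝ᵥ ((v • S)⁻¹ *ᵥ (x - μ))) ^ (-(v + Fintype.card ι) / 2)

namespace Matrix

variable {m n : Type*} [Fintype m] [DecidableEq m] [Fintype n] [DecidableEq n]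

lemma PosDef.schur_complement₁₁ {A : Matrix m m ℝ} {B : Matrix m n ℝ} {D : Matrix n n ℝ}
    (h : (fromBlocks A B Bᴴ D).PosDef) : (D - Bᴴ * A⁻¹ * B).PosDef := by
  have hA : A.PosDef := h.submatrix Sum.inl_injective
  have := hA.isUnit.invertible
  refine ((PosDef.fromBlocks₁₁ B D hA).1 h.posSemidef).posDef_iff_det_ne_zero.2 fun h0 ↦ ?_
  have := h.det_pos
  rw [det_fromBlocks₁₁, invOf_eq_nonsing_inv, h0, mul_zero] at this
  exact this.false

lemma PosDef.dotProduct_inv_fromBlocks_mulVec {A : Matrix m m ℝ} {B : Matrix m n ℝ}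
    {D : Matrix n n ℝ} (h : (fromBlocks A B Bᴴ D).PosDef) (x : m → ℝ) (y : n → ℝ) :
    Sum.elim x y ⬝ᵥ ((fromBlocks A B Bᴴ D)⁻¹ *ᵥ Sum.elim x y) =
      x ⬝ᵥ (A⁻¹ *ᵥ x) + (y - (Bᴴ * A⁻¹) *ᵥ x) ⬝ᵥ
        ((D - Bᴴ * A⁻¹ * B)⁻¹ *ᵥ (y - (Bᴴ * A⁻¹) *ᵥ x)) := by
  have hA : A.PosDef := h.submatrix Sum.inl_injective
  have hAu : IsUnit A.det := hA.det_pos.ne'.isUnit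
  have hSu : IsUnit (D - Bᴴ * A⁻¹ * B).det := h.schur_complement₁₁.det_pos.ne'.isUnit
  have hMu : IsUnit (fromBlocks A B Bᴴ D).det := h.det_pos.ne'.isUnit
  set w := (D - Bᴴ * A⁻¹ * B)⁻¹ *ᵥ (y - (Bᴴ * A⁻¹) *ᵥ x) with hw
  have hSw : (D - Bᴴ * A⁻¹ * B) *ᵥ w = y - (Bᴴ * A⁻¹) *ᵥ x := by
    rw [hw, mulVec_mulVec, mul_nonsing_inv _ hSu, one_mulVec]
  have hz : fromBlocks A B Bᴴ D *ᵥ Sum.elim (A⁻¹ *ᵥ (x - B *ᵥ w)) w = Sum.elim x y := by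
    rw [fromBlocks_mulVec]
    simp only [Sum.elim_comp_inl, Sum.elim_comp_inr, mulVec_mulVec, mul_nonsing_inv _ hAu,
      one_mulVec, sub_add_cancel]
    congr 1
    rw [sub_mulVec] at hSw
    rw [mulVec_sub, mulVec_mulVec, sub_add, ← neg_sub (D *ᵥ w), hSw]
    abel
  have hinv : (fromBlocks A B Bᴴ D)⁻¹ *ᵥ Sum.elim x y = Sum.elim (A⁻¹ *ᵥ (x - B *ᵥ w)) w := by
    rw [← hz, mulVec_mulVec, nonsing_inv_mul _ hMu, one_mulVec]
  have hadj : x ⬝ᵥ (A⁻¹ *ᵥ (B *ᵥ w)) = ((Bᴴ * A⁻¹) *ᵥ x) ⬝ᵥ w := by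
    have hT : (Bᴴ * A⁻¹)ᵀ = A⁻¹ * B := by
      have : (A⁻¹)ᵀ = A⁻¹ := by simpa using hA.inv.isHermitian.eq
      rw [transpose_mul, this, conjTranspose_eq_transpose_of_trivial, transpose_transpose]
    rw [mulVec_mulVec, ← hT, dotProduct_mulVec, vecMul_transpose]
  rw [hinv, sumElim_dotProduct_sumElim, mulVec_sub, dotProduct_sub, hadj, sub_dotProduct]
  ring

end Matrix

section GaussianIntegral

variable {ι : Type*} [Fintype ι]

lemma integrable_exp_neg_mul_dotProduct_self {t : ℝ} (ht : 0 < t) :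
    Integrable fun x : ι → ℝ ↦ rexp (-t * (x ⬝ᵥ x)) := by
  have := Integrable.fintype_prod (ι := ι) fun _ ↦ integrable_exp_neg_mul_sq ht
  simp only [← Real.exp_sum, ← Finset.mul_sum] at this
  simpa only [dotProduct, ← pow_two, volume_pi] using this

lemma integral_exp_neg_mul_dotProduct_self {t : ℝ} (ht : 0 < t) :
    ∫ x : ι → ℝ, rexp (-t * (x ⬝ᵥ x)) = (π / t) ^ ((Fintype.card ι : ℝ) / 2) := by
  have := integral_fintype_prod_volume_eq_pow (ι := ι) fun y : ℝ ↦ rexp (-t * y ^ 2)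
  simp only [← Real.exp_sum, ← Finset.mul_sum, integral_gaussian] at this
  simp only [dotProduct, ← pow_two, this]
  rw [Real.sqrt_eq_rpow, ← Real.rpow_mul_natCast (by positivity)]
  ring_nf

variable [DecidableEq ι]

open scoped MatrixOrder in
lemma Matrix.PosDef.exists_dotProduct_mulVec_eq {M : Matrix ι ι ℝ} (hM : M.PosDef) :
    ∃ B : Matrix ι ι ℝ, |B.det| = M.det ^ (1 / 2 : ℝ) ∧
      ∀ x, x ⬝ᵥ (M *ᵥ x) = (B *ᵥ x) ⬝ᵥ (B *ᵥ x) := by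
  obtain ⟨B, rfl⟩ := CStarAlgebra.nonneg_iff_eq_star_mul_self.mp hM.posSemidef.nonneg
  refine ⟨B, ?_, fun x ↦ ?_⟩
  · rw [star_eq_conjTranspose, conjTranspose_eq_transpose_of_trivial, det_mul, det_transpose,
      ← Real.sqrt_eq_rpow, Real.sqrt_mul_self_eq_abs]
  · rw [star_eq_conjTranspose, conjTranspose_eq_transpose_of_trivial, ← mulVec_mulVec,
      dotProduct_mulVec, vecMul_transpose]

lemma Matrix.PosDef.integrable_exp_neg_mul {M : Matrix ι ι ℝ} (hM : M.PosDef) {t : ℝ}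
    (ht : 0 < t) : Integrable fun x : ι → ℝ ↦ rexp (-t * (x ⬝ᵥ (M *ᵥ x))) := by
  obtain ⟨B, hB, h⟩ := hM.exists_dotProduct_mulVec_eq
  have hB0 : B.det ≠ 0 := abs_pos.1 (hB ▸ Real.rpow_pos_of_pos hM.det_pos _)
  have hmap := Real.map_matrix_volume_pi_eq_smul_volume_pi hB0
  have hint := (integrable_exp_neg_mul_dotProduct_self (ι := ι) ht).smul_measure
    (c := ENNReal.ofReal |B.det⁻¹|) ENNReal.ofReal_ne_top
  rw [← hmap, integrable_map_measure (hmap ▸ hint.aestronglyMeasurable)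
    (LinearMap.continuous_of_finiteDimensional _).aemeasurable] at hint
  simpa only [h, Function.comp_def, toLin'_apply] using hint

lemma Matrix.PosDef.integral_exp_neg_mul {M : Matrix ι ι ℝ} (hM : M.PosDef) {t : ℝ}
    (ht : 0 < t) : ∫ x : ι → ℝ, rexp (-t * (x ⬝ᵥ (M *ᵥ x))) =
      (π / t) ^ ((Fintype.card ι : ℝ) / 2) / M.det ^ (1 / 2 : ℝ) := by
  obtain ⟨B, hB, h⟩ := hM.exists_dotProduct_mulVec_eq
  have hB0 : B.det ≠ 0 := abs_pos.1 (hB ▸ Real.rpow_pos_of_pos hM.det_pos _)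
  have hmap := Real.map_matrix_volume_pi_eq_smul_volume_pi hB0
  have hint := (integrable_exp_neg_mul_dotProduct_self (ι := ι) ht).smul_measure
    (c := ENNReal.ofReal |B.det⁻¹|) ENNReal.ofReal_ne_top
  have := integral_map (LinearMap.continuous_of_finiteDimensional (toLin' B)).aemeasurable
    (hmap ▸ hint.aestronglyMeasurable)
  simp only [toLin'_apply, ← h] at this
  rw [← this, hmap, integral_smul_measure, integral_exp_neg_mul_dotProduct_self ht,
    ENNReal.toReal_ofReal (abs_nonneg _), abs_inv, hB, smul_eq_mul, inv_mul_eq_div]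

/-- The Student-t type integral of a power of a positive definite quadratic form, obtained by
writing the power as a Gamma integral of Gaussians. -/
lemma Matrix.PosDef.integral_add_rpow_neg {M : Matrix ι ι ℝ} (hM : M.PosDef) {a c : ℝ}
    (hc : 0 < c) (ha : (Fintype.card ι : ℝ) / 2 < a) :
    ∫ x : ι → ℝ, (c + x ⬝ᵥ (M *ᵥ x)) ^ (-a) =
      π ^ ((Fintype.card ι : ℝ) / 2) / M.det ^ (1 / 2 : ℝ) *
        (Real.Gamma (a - Fintype.card ι / 2) / Real.Gamma a) *
        c ^ (-(a - Fintype.card ι / 2)) := by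
  set d : ℝ := (Fintype.card ι : ℝ) / 2
  have hd0 : 0 ≤ d := by positivity
  have ha0 : 0 < a := hd0.trans_lt ha
  have hG : 0 < Real.Gamma a := Real.Gamma_pos_of_pos ha0
  let K : (ι → ℝ) → ℝ → ℝ := fun x t ↦ t ^ (a - 1) * rexp (-((c + x ⬝ᵥ (M *ᵥ x)) * t))
  have hK (x : ι → ℝ) (t : ℝ) :
      K x t = t ^ (a - 1) * rexp (-(c * t)) * rexp (-t * (x ⬝ᵥ (M *ᵥ x))) := by
    rw [mul_assoc, ← Real.exp_add]; simp only [K]; ring_nf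
  have hinner {t : ℝ} (ht : 0 < t) :
      ∫ x, K x t = π ^ d / M.det ^ (1 / 2 : ℝ) * (t ^ (a - d - 1) * rexp (-(c * t))) := by
    simp only [hK, integral_const_mul, hM.integral_exp_neg_mul ht]
    rw [Real.div_rpow pi_pos.le ht.le, show a - d - 1 = (a - 1) - d by ring,
      Real.rpow_sub ht (a - 1)]
    ring
  have hq (x : ι → ℝ) : 0 < c + x ⬝ᵥ (M *ᵥ x) := by
    have := hM.posSemidef.dotProduct_mulVec_nonneg x
    rw [star_trivial] at this
    linarith
  have houter (x : ι → ℝ) :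
      ∫ t in Set.Ioi 0, K x t = Real.Gamma a * (c + x ⬝ᵥ (M *ᵥ x)) ^ (-a) := by
    rw [Real.integral_rpow_mul_exp_neg_mul_Ioi ha0 (hq x), one_div, Real.inv_rpow (hq x).le,
      Real.rpow_neg (hq x).le, mul_comm]
  have hmeas : Measurable (Function.uncurry K) := by
    have : Continuous fun x : ι → ℝ ↦ x ⬝ᵥ (M *ᵥ x) := by fun_prop
    have := this.measurable
    simp only [K, Function.uncurry_def]
    fun_prop
  have hint : Integrable (Function.uncurry K)
      ((volume : Measure (ι → ℝ)).prod (volume.restrict (Set.Ioi 0))) := by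
    rw [integrable_prod_iff' hmeas.aestronglyMeasurable]
    constructor
    · filter_upwards [ae_restrict_mem measurableSet_Ioi] with t ht
      simp only [Function.uncurry_apply_pair, hK]
      exact (hM.integrable_exp_neg_mul ht).const_mul _
    · have h := (integrableOn_rpow_mul_exp_neg_mul_rpow (s := a - d - 1) (by linarith)
        one_pos hc).const_mul (π ^ d / M.det ^ (1 / 2 : ℝ))
      refine Integrable.congr h ?_
      filter_upwards [ae_restrict_mem measurableSet_Ioi] with t ht
      have hn (x : ι → ℝ) : ‖K x t‖ = K x t :=
        Real.norm_of_nonneg (mul_nonneg (Real.rpow_nonneg (le_of_lt ht) _) (Real.exp_nonneg _))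
      simp only [Function.uncurry_apply_pair, hn, hinner ht, Real.rpow_one, neg_mul]
  have hswap := integral_integral_swap hint
  simp only [houter, integral_const_mul] at hswap
  rw [setIntegral_congr_fun measurableSet_Ioi fun t ht ↦ hinner ht, integral_const_mul,
    Real.integral_rpow_mul_exp_neg_mul_Ioi (sub_pos.2 ha) hc, one_div c, Real.inv_rpow hc.le,
    ← Real.rpow_neg hc.le] at hswap
  rw [← mul_right_inj' hG.ne', hswap]
  field_simp

end GaussianIntegral

lemma St_eq_det_smul {ι : Type*} [Fintype ι] [DecidableEq ι] {v : ℝ} (hv : 0 < v) (μ : ι → ℝ)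
    {S : Matrix ι ι ℝ} (hS : S.PosDef) (x : ι → ℝ) :
    St v μ S x = Real.Gamma ((v + Fintype.card ι) / 2) /
      (π ^ ((Fintype.card ι : ℝ) / 2) * Real.Gamma (v / 2) * (v • S).det ^ ((1 : ℝ) / 2)) *
      (1 + (x - μ) ⬝ᵥ ((v • S)⁻¹ *ᵥ (x - μ))) ^ (-((v + Fintype.card ι) / 2)) := by
  rw [St, det_smul, Real.mul_rpow pi_pos.le hv.le, Real.mul_rpow (by positivity) hS.det_pos.le,
    ← Real.rpow_natCast_mul hv.le, neg_div]
  ring_nf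

/-- Marginal distribution of the multivariate Student-t: integrating out the second
block of variables yields a Student-t with the same degrees of freedom, location `μ₁`
and scale `Σ₁₁`. -/
theorem studentT_marginal (n₁ n₂ : ℕ) (hn₁ : 0 < n₁) (hn₂ : 0 < n₂)
    (v : ℝ) (hv : 0 < v) (μ : Fin n₁ ⊕ Fin n₂ → ℝ)
    (S : Matrix (Fin n₁ ⊕ Fin n₂) (Fin n₁ ⊕ Fin n₂) ℝ)
    (hS : S.IsSymm) (hSpd : S.PosDef) (x₁ : Fin n₁ → ℝ) :
    (∫ x₂ : Fin n₂ → ℝ, St v μ S (Sum.elim x₁ x₂))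
      = St v (μ ∘ Sum.inl) S.toBlocks₁₁ x₁ := by
  have hS₁ : S.toBlocks₁₁.PosDef := hSpd.submatrix Sum.inl_injective
  simp only [St_eq_det_smul hv _ hSpd, St_eq_det_smul hv _ hS₁]
  set A := v • S.toBlocks₁₁ with hA
  set B := v • S.toBlocks₁₂ with hB
  set D := v • S.toBlocks₂₂ with hD
  have hT : v • S = fromBlocks A B Bᴴ D := by
    have h₂₁ : S.toBlocks₂₁ = S.toBlocks₁₂ᴴ := by
      ext i j
      exact (hS.apply _ _).symm
    rw [hA, hB, hD, conjTranspose_smul, ← h₂₁, star_trivial, ← fromBlocks_smul, fromBlocks_toBlocks]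
  have hpd : (fromBlocks A B Bᴴ D).PosDef := hT ▸ hSpd.smul hv
  have hApd : A.PosDef := hS₁.smul hv
  have hSchur := hpd.schur_complement₁₁
  have hdet : (fromBlocks A B Bᴴ D).det = A.det * (D - Bᴴ * A⁻¹ * B).det := by
    have := hApd.isUnit.invertible
    rw [det_fromBlocks₁₁, invOf_eq_nonsing_inv]
  have hsub (x₂ : Fin n₂ → ℝ) :
      Sum.elim x₁ x₂ - μ = Sum.elim (x₁ - μ ∘ Sum.inl) (x₂ - μ ∘ Sum.inr) := by
    ext (i | i) <;> rfl
  set y := x₁ - μ ∘ Sum.inl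
  have hc : 0 < 1 + y ⬝ᵥ (A⁻¹ *ᵥ y) := by
    have := hApd.inv.posSemidef.dotProduct_mulVec_nonneg y
    rw [star_trivial] at this
    linarith
  have hexp : (v + (Fintype.card (Fin n₁ ⊕ Fin n₂) : ℝ)) / 2 - (Fintype.card (Fin n₂) : ℝ) / 2 =
      (v + Fintype.card (Fin n₁)) / 2 := by
    simp; ring
  simp only [hT, hsub, hpd.dotProduct_inv_fromBlocks_mulVec, integral_const_mul, ← add_assoc,
    sub_sub]
  rw [integral_sub_right_eq_self (fun x₂ : Fin n₂ → ℝ ↦ (1 + y ⬝ᵥ (A⁻¹ *ᵥ y) + x₂ ⬝ᵥ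
    ((D - Bᴴ * A⁻¹ * B)⁻¹ *ᵥ x₂)) ^ (-((v + Fintype.card (Fin n₁ ⊕ Fin n₂)) / 2))),
    hSchur.inv.integral_add_rpow_neg hc (sub_pos.1 (hexp ▸ by positivity)), hdet,
    Real.mul_rpow hApd.det_pos.le hSchur.det_pos.le, det_nonsing_inv, Ring.inverse_eq_inv',
    Real.inv_rpow hSchur.det_pos.le]
  have hpi : π ^ ((Fintype.card (Fin n₁ ⊕ Fin n₂) : ℝ) / 2) =
      π ^ ((Fintype.card (Fin n₁) : ℝ) / 2) * π ^ ((Fintype.card (Fin n₂) : ℝ) / 2) := by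
    rw [← Real.rpow_add pi_pos]; simp; ring_nf
  have hΓ : 0 < Real.Gamma ((v + (Fintype.card (Fin n₁ ⊕ Fin n₂) : ℝ)) / 2) :=
    Real.Gamma_pos_of_pos (by positivity)
  have hΓv : 0 < Real.Gamma (v / 2) := Real.Gamma_pos_of_pos (by positivity)
  have hdA := Real.rpow_pos_of_pos hApd.det_pos (1 / 2)
  have hdS := Real.rpow_pos_of_pos hSchur.det_pos (1 / 2)
  rw [hexp, hpi]
  field_simp
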